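/- arXiv:2602.01462 — 2 statements merged into one kernel-verified Lean document; each statement's English description precedes it below -/
import Mathlib

section
/- Let F be a pliable family of subsets of a finite ground set V that satisfies symmetry and structural submodularity, and let Ê be any set of edges on V. Then every set S∈F_Ê crosses at most one inclusion-minimal member of F_Ê. -/
/-- Two subsets `A, B` of the ground set `V` cross if all four sets
`A ∩ B`, `A \ B`, `B \ A`, `V \ (A ∪ B)` are nonempty. -/
def Crosses {V : Type*} (A B : Set V) : Prop :=
  (A ∩ B).Nonempty ∧ (A \ B).Nonempty ∧ (B \ A).Nonempty ∧
    (Set.univ \ (A ∪ B)).Nonempty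

/-- At least two of the four propositions hold. -/
def AtLeastTwo (p q r s : Prop) : Prop :=
  (p ∧ q) ∨ (p ∧ r) ∨ (p ∧ s) ∨ (q ∧ r) ∨ (q ∧ s) ∨ (r ∧ s)

/-- A family `F` of subsets of `V` (with `∅ ∉ F` and `V ∉ F`) is pliable if for
every pair `A, B ∈ F`, at least two of `A ∩ B`, `A ∪ B`, `A \ B`, `B \ A` are in `F`. -/
def Pliable {V : Type*} (F : Set (Set V)) : Prop :=
  ∅ ∉ F ∧ Set.univ ∉ F ∧
    ∀ A ∈ F, ∀ B ∈ F, AtLeastTwo (A ∩ B ∈ F) (A ∪ B ∈ F) (A \ B ∈ F) (B \ A ∈ F)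

/-- `F` satisfies symmetry: `S ∈ F` iff `V \ S ∈ F`. -/
def SymmFamily {V : Type*} (F : Set (Set V)) : Prop :=
  ∀ S : Set V, S ∈ F ↔ (Set.univ \ S) ∈ F

/-- `F` satisfies structural submodularity: for every crossing pair `A, B ∈ F`,
at least one of `A ∩ B`, `A ∪ B` is in `F` and at least one of `A \ B`, `B \ A` is in `F`. -/
def StructSubmodular {V : Type*} (F : Set (Set V)) : Prop :=
  ∀ A ∈ F, ∀ B ∈ F, Crosses A B →
    ((A ∩ B ∈ F ∨ A ∪ B ∈ F) ∧ (A \ B ∈ F ∨ B \ A ∈ F))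

/-- `δ_J(S)`: the edges (unordered pairs) of `J` with exactly one endpoint in `S`. -/
def cutLinks {V : Type*} (J : Set (Sym2 V)) (S : Set V) : Set (Sym2 V) :=
  {e ∈ J | ∃ x y, e = s(x, y) ∧ x ∈ S ∧ y ∉ S}

/-- `F_Ê`: the members of `F` not covered by the edge set `Ê`. -/
def uncovered {V : Type*} (F : Set (Set V)) (E : Set (Sym2 V)) : Set (Set V) :=
  {S ∈ F | cutLinks E S = ∅}

/-- `C` is an inclusion-minimal member of `F`: `C ∈ F` and no proper subset of `C` is in `F`. -/
def MinimalIn {V : Type*} (F : Set (Set V)) (C : Set V) : Prop :=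
  C ∈ F ∧ ∀ S : Set V, S ⊂ C → S ∉ F

/-- `C_Ê`: the family of inclusion-minimal members of `F_Ê`. -/
def cores {V : Type*} (F : Set (Set V)) (E : Set (Sym2 V)) : Set (Set V) :=
  {C | MinimalIn (uncovered F E) C}

theorem mem_uncovered_iff {V : Type*} {F : Set (Set V)} {E : Set (Sym2 V)} {S : Set V} :
    S ∈ uncovered F E ↔ S ∈ F ∧ ∀ x y, s(x, y) ∈ E → (x ∈ S ↔ y ∈ S) := by
  refine and_congr_right fun _ => ⟨fun h x y hxy => ?_, fun h => ?_⟩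
  · by_contra hne
    rw [Set.eq_empty_iff_forall_notMem] at h
    by_cases hx : x ∈ S
    · exact h s(x, y) ⟨hxy, x, y, rfl, hx, fun hy => hne (by simp [hx, hy])⟩
    · exact h s(x, y) ⟨hxy, y, x, Sym2.eq_swap, by tauto, hx⟩
  · rw [Set.eq_empty_iff_forall_notMem]
    rintro _ ⟨he, x, y, rfl, hx, hy⟩
    exact hy ((h x y he).1 hx)

section Uncovered

variable {V : Type*} {F : Set (Set V)} {E : Set (Sym2 V)} {A B : Set V}

theorem inter_mem_uncovered (hA : A ∈ uncovered F E) (hB : B ∈ uncovered F E)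
    (h : A ∩ B ∈ F) : A ∩ B ∈ uncovered F E := by
  rw [mem_uncovered_iff] at *
  exact ⟨h, fun x y hxy => and_congr (hA.2 x y hxy) (hB.2 x y hxy)⟩

theorem union_mem_uncovered (hA : A ∈ uncovered F E) (hB : B ∈ uncovered F E)
    (h : A ∪ B ∈ F) : A ∪ B ∈ uncovered F E := by
  rw [mem_uncovered_iff] at *
  exact ⟨h, fun x y hxy => or_congr (hA.2 x y hxy) (hB.2 x y hxy)⟩

theorem diff_mem_uncovered (hA : A ∈ uncovered F E) (hB : B ∈ uncovered F E)
    (h : A \ B ∈ F) : A \ B ∈ uncovered F E := by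
  rw [mem_uncovered_iff] at *
  exact ⟨h, fun x y hxy => and_congr (hA.2 x y hxy) (not_congr (hB.2 x y hxy))⟩

end Uncovered

theorem Pliable.uncovered {V : Type*} {F : Set (Set V)} (h : Pliable F) (E : Set (Sym2 V)) :
    Pliable (uncovered F E) := by
  refine ⟨fun h' => h.1 h'.1, fun h' => h.2.1 h'.1, fun A hA B hB => ?_⟩
  have hAB := h.2.2 A hA.1 B hB.1
  have h₁ := inter_mem_uncovered hA hB
  have h₂ := union_mem_uncovered hA hB
  have h₃ := diff_mem_uncovered hA hB
  have h₄ := diff_mem_uncovered hB hA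
  unfold AtLeastTwo at *
  tauto

theorem StructSubmodular.uncovered {V : Type*} {F : Set (Set V)} (h : StructSubmodular F)
    (E : Set (Sym2 V)) : StructSubmodular (uncovered F E) := fun A hA B hB hAB =>
  ⟨(h A hA.1 B hB.1 hAB).1.imp (inter_mem_uncovered hA hB) (union_mem_uncovered hA hB),
    (h A hA.1 B hB.1 hAB).2.imp (diff_mem_uncovered hA hB) (diff_mem_uncovered hB hA)⟩

section Minimal

variable {V : Type*} {G : Set (Set V)} {S C D : Set V}

theorem MinimalIn.inter_notMem (hC : MinimalIn G C) (h : (C \ S).Nonempty) : C ∩ S ∉ G :=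
  hC.2 _ ⟨Set.inter_subset_left, fun hs => let ⟨_, hx⟩ := h; hx.2 (hs hx.1).2⟩

theorem MinimalIn.diff_notMem (hC : MinimalIn G C) (h : (C ∩ S).Nonempty) : C \ S ∉ G :=
  hC.2 _ ⟨Set.sdiff_subset, fun hs => let ⟨_, hx⟩ := h; (hs hx.1).2 hx.2⟩

theorem Pliable.union_mem_and_diff_mem (hG : Pliable G) (hS : S ∈ G) (hC : MinimalIn G C)
    (h₁ : (C ∩ S).Nonempty) (h₂ : (C \ S).Nonempty) : S ∪ C ∈ G ∧ S \ C ∈ G := by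
  have h := hG.2.2 S hS C hC.1
  have h₃ := hC.diff_notMem h₁
  have h₄ := hC.inter_notMem h₂
  rw [Set.inter_comm] at h₄
  unfold AtLeastTwo at h
  tauto

theorem Pliable.disjoint_of_minimalIn (hG : Pliable G) (hC : MinimalIn G C)
    (hD : MinimalIn G D) (hne : C ≠ D) : Disjoint C D := by
  rw [Set.disjoint_iff_inter_eq_empty, ← Set.not_nonempty_iff_eq_empty]
  intro h
  have hDC : (D \ C).Nonempty := by
    rw [Set.sdiff_nonempty]
    exact fun hs => hC.2 D (hs.ssubset_of_ne hne.symm) hD.1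
  have hCD := (hG.union_mem_and_diff_mem hC.1 hD (Set.inter_comm C D ▸ h) hDC).2
  exact hC.diff_notMem h hCD

/-- In a pliable, structurally submodular family, a member crosses at most one minimal member. -/
theorem Pliable.eq_of_crosses_minimalIn (hG : Pliable G) (hSub : StructSubmodular G)
    (hS : S ∈ G) (hC : MinimalIn G C) (hD : MinimalIn G D) (hSC : Crosses S C)
    (hSD : Crosses S D) : C = D := by
  by_contra hne
  have hdis : ∀ x ∈ C, x ∉ D := fun _ h => (hG.disjoint_of_minimalIn hC hD hne).notMem_of_mem_left h
  obtain ⟨⟨a, haS, haC⟩, -, ⟨b, hbC, hbS⟩, -⟩ := hSC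
  obtain ⟨⟨c, hcS, hcD⟩, -, ⟨d, hdD, hdS⟩, -⟩ := hSD
  have hdiff := (hG.union_mem_and_diff_mem hS hC ⟨a, haC, haS⟩ ⟨b, hbC, hbS⟩).2
  have hT := (hG.union_mem_and_diff_mem hdiff hD
    ⟨c, hcD, hcS, fun h => hdis c h hcD⟩ ⟨d, hdD, fun h => hdS h.1⟩).1
  have h₁ : S \ (S \ C ∪ D) = C ∩ S := by
    ext x
    have := hdis x
    simp only [Set.mem_sdiff, Set.mem_union, Set.mem_inter_iff]
    tauto
  have h₂ : (S \ C ∪ D) \ S = D \ S := by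
    ext x
    simp only [Set.mem_sdiff, Set.mem_union]
    tauto
  have hcross : Crosses S (S \ C ∪ D) :=
    ⟨⟨c, hcS, Or.inr hcD⟩, h₁ ▸ ⟨a, haC, haS⟩, h₂ ▸ ⟨d, hdD, hdS⟩,
      ⟨b, trivial, fun h => h.elim hbS fun h => h.elim (fun h => hbS h.1) (hdis b hbC)⟩⟩
  rcases (hSub S hS _ hT hcross).2 with h | h
  · exact hC.inter_notMem ⟨b, hbC, hbS⟩ (h₁ ▸ h)
  · exact hD.diff_notMem ⟨c, hcD, hcS⟩ (h₂ ▸ h)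

end Minimal

/-- every `S ∈ F_Ê` crosses at most one inclusion-minimal member of `F_Ê`. -/
theorem stmt4 {V : Type*} [Fintype V] (F : Set (Set V)) (E : Set (Sym2 V))
    (hPl : Pliable F) (hSym : SymmFamily F) (hSub : StructSubmodular F) :
    ∀ S ∈ uncovered F E, {C : Set V | C ∈ cores F E ∧ Crosses S C}.ncard ≤ 1 := by
  intro S hS
  rw [Set.ncard_le_one (Set.toFinite _)]
  rintro C ⟨hC, hSC⟩ D ⟨hD, hSD⟩
  exact (hPl.uncovered E).eq_of_crosses_minimalIn (hSub.uncovered E) hS hC hD hSC hSD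
end

section
/- Let F be a pliable family of subsets of a finite ground set V that satisfies symmetry and structural submodularity. Then F satisfies property (γ): for any set Ê of edges and sets S0,S1∈F_Ê with S1⊊S0, if an inclusion-minimal set C∈C_Ê crosses both S0 and S1, then the set S0\(C∪S1) is either empty or belongs to F_Ê. -/
/-- Property (γ). -/
def PropGamma {V : Type*} (F : Set (Set V)) : Prop :=
  ∀ (E : Set (Sym2 V)) (S₀ S₁ C : Set V),
    S₀ ∈ uncovered F E → S₁ ∈ uncovered F E → S₁ ⊂ S₀ →
    C ∈ cores F E → Crosses C S₀ → Crosses C S₁ →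
    S₀ \ (C ∪ S₁) = ∅ ∨ S₀ \ (C ∪ S₁) ∈ uncovered F E

/-- Property (γ*). -/
def PropGammaStar {V : Type*} (F : Set (Set V)) : Prop :=
  ∀ (E : Set (Sym2 V)) (k : ℕ), 1 ≤ k →
    ∀ (S₀ : Set V) (S : Fin k → Set V) (C : Set V),
      S₀ ∈ uncovered F E → (∀ i, S i ∈ uncovered F E) →
      (∀ i, S i ⊂ S₀) → (∀ i j, i ≠ j → Disjoint (S i) (S j)) →
      C ∈ cores F E → Crosses C S₀ → (∀ i, Crosses C (S i)) →
      S₀ \ ((⋃ i, S i) ∪ C) = ∅ ∨ S₀ \ ((⋃ i, S i) ∪ C) ∈ uncovered F E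

theorem cutLinks_eq_empty_iff {V : Type*} {E : Set (Sym2 V)} {S : Set V} :
    cutLinks E S = ∅ ↔ ∀ x y, s(x, y) ∈ E → x ∈ S → y ∈ S := by
  constructor
  · intro h x y he hx
    by_contra hy
    have : s(x, y) ∈ cutLinks E S := ⟨he, x, y, rfl, hx, hy⟩
    simp [h] at this
  · intro h
    rw [Set.eq_empty_iff_forall_notMem]
    rintro e ⟨he, x, y, rfl, hx, hy⟩
    exact hy (h x y he hx)

theorem cutLinks_union_eq_empty {V : Type*} {E : Set (Sym2 V)} {A B : Set V}
    (hA : cutLinks E A = ∅) (hB : cutLinks E B = ∅) : cutLinks E (A ∪ B) = ∅ := by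
  rw [cutLinks_eq_empty_iff] at *
  exact fun x y he => Or.imp (hA x y he) (hB x y he)

theorem cutLinks_inter_eq_empty {V : Type*} {E : Set (Sym2 V)} {A B : Set V}
    (hA : cutLinks E A = ∅) (hB : cutLinks E B = ∅) : cutLinks E (A ∩ B) = ∅ := by
  rw [cutLinks_eq_empty_iff] at *
  exact fun x y he => And.imp (hA x y he) (hB x y he)

theorem cutLinks_diff_eq_empty {V : Type*} {E : Set (Sym2 V)} {A B : Set V}
    (hA : cutLinks E A = ∅) (hB : cutLinks E B = ∅) : cutLinks E (A \ B) = ∅ := by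
  rw [cutLinks_eq_empty_iff] at *
  exact fun x y he hx => ⟨hA x y he hx.1, fun hy => hx.2 (hB y x (Sym2.eq_swap ▸ he) hy)⟩

/-- The union of a core with an uncovered set that it crosses is uncovered. -/
theorem union_mem_of_core_crosses {V : Type*} {F : Set (Set V)} (hSub : StructSubmodular F)
    {E : Set (Sym2 V)} {C S : Set V} (hC : C ∈ cores F E) (hS : S ∈ uncovered F E)
    (hCS : Crosses C S) : C ∪ S ∈ uncovered F E := by
  obtain ⟨hCF, hmin⟩ := hC
  refine ⟨(hSub C hCF.1 S hS.1 hCS).1.resolve_left fun h => ?_,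
    cutLinks_union_eq_empty hCF.2 hS.2⟩
  obtain ⟨x, hx, hxS⟩ := hCS.2.1
  exact hmin _ ⟨Set.inter_subset_left, fun hle => hxS (hle hx).2⟩
    ⟨h, cutLinks_inter_eq_empty hCF.2 hS.2⟩

/-- a pliable family satisfying symmetry and structural
submodularity satisfies property (γ). -/
theorem stmt5 {V : Type*} [Fintype V] (F : Set (Set V))
    (hPl : Pliable F) (hSym : SymmFamily F) (hSub : StructSubmodular F) :
    PropGamma F := by
  intro E S₀ S₁ C h₀ h₁ hlt hC hC₀ hC₁
  refine or_iff_not_imp_left.mpr fun hne => ?_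
  have hD := union_mem_of_core_crosses hSub hC h₁ hC₁
  have hdiff : (C ∪ S₁) \ S₀ = C \ S₀ := by
    rw [Set.union_sdiff_distrib, Set.sdiff_eq_empty.mpr hlt.subset, Set.union_empty]
  have hcross : Crosses S₀ (C ∪ S₁) := by
    refine ⟨?_, Set.nonempty_iff_ne_empty.mpr hne, hdiff ▸ hC₀.2.1, ?_⟩
    · obtain ⟨x, hxC, hx⟩ := hC₀.1
      exact ⟨x, hx, Or.inl hxC⟩
    · obtain ⟨x, hx, hxn⟩ := hC₀.2.2.2
      refine ⟨x, hx, ?_⟩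
      rintro (h | h | h)
      exacts [hxn (Or.inr h), hxn (Or.inl h), hxn (Or.inr (hlt.subset h))]
  refine ⟨(hSub S₀ h₀.1 _ hD.1 hcross).2.resolve_right fun h => ?_,
    cutLinks_diff_eq_empty h₀.2 hD.2⟩
  obtain ⟨x, hxC, hx⟩ := hC₀.1
  exact hC.2 _ ⟨Set.sdiff_subset, fun hle => (hle hxC).2 hx⟩
    ⟨hdiff ▸ h, cutLinks_diff_eq_empty hC.1.2 h₀.2⟩
end
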